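/- arXiv:1706.09194 — 5 statements merged into one kernel-verified Lean document; each statement's English description precedes it below -/
import Mathlib

section
/- Let (V_n)_{n∈ℕ} be finite-dimensional vector spaces over ℚ, let f_n : V_{n+1} → V_n be linear maps, and for each n let A_n ⊆ V_n be a nonempty affine subspace such that f_n maps A_{n+1} into A_n. Then there exists a sequence (a_n) with a_n ∈ A_n and f_n(a_{n+1}) = a_n for all n; that is, the inverse limit of the system (A_n, f_n) is nonempty. -/
namespace AffineSubspace

/-- A decreasing sequence of nonempty affine subspaces of an Artinian module stabilizes. -/
theorem antitone_stabilizes_of_nonempty {k E : Type*} [Ring k] [AddCommGroup E] [Module k E]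
    [IsArtinian k E] {s : ℕ → AffineSubspace k E} (hs : Antitone s)
    (hne : ∀ n, (s n : Set E).Nonempty) : ∃ n, ∀ m, n ≤ m → s m = s n := by
  obtain ⟨n, hn⟩ := IsArtinian.monotone_stabilizes (R := k) (M := E)
    ⟨fun i ↦ OrderDual.toDual (s i).direction, fun _ _ h ↦ direction_le (hs h)⟩
  exact ⟨n, fun m hm ↦ eq_of_direction_eq_of_nonempty_of_le (hn m hm).symm (hne m) (hs hm)⟩

section Tower

variable {k : Type*} [Ring k] {V : ℕ → Type*} [∀ n, AddCommGroup (V n)] [∀ n, Module k (V n)]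

/-- The image in `V n` of the affine subspace `A (n + i)` of a tower. -/
def iteratedImage (f : ∀ n, V (n + 1) →ₗ[k] V n) (A : ∀ n, AffineSubspace k (V n)) :
    ℕ → ∀ n, AffineSubspace k (V n)
  | 0, n => A n
  | i + 1, n => (iteratedImage f A i (n + 1)).map (f n).toAffineMap

variable {f : ∀ n, V (n + 1) →ₗ[k] V n} {A : ∀ n, AffineSubspace k (V n)}

theorem iteratedImage_nonempty (hne : ∀ n, (A n : Set (V n)).Nonempty) (i n : ℕ) :
    (iteratedImage f A i n : Set (V n)).Nonempty := by
  induction i generalizing n with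
  | zero => exact hne n
  | succ i ih => exact (ih (n + 1)).image _

theorem antitone_iteratedImage (hmap : ∀ n, ∀ x ∈ A (n + 1), f n x ∈ A n) (n : ℕ) :
    Antitone fun i ↦ iteratedImage f A i n := by
  refine antitone_nat_of_succ_le fun i ↦ ?_
  induction i generalizing n with
  | zero =>
    rintro _ ⟨x, hx, rfl⟩
    exact hmap n x hx
  | succ i ih => exact map_mono _ (ih (n + 1))

/-- A tower of nonempty affine subspaces of Artinian modules contains a tower of nonempty affine
subspaces with surjective transition maps. -/
theorem exists_le_map_eq [∀ n, IsArtinian k (V n)] (hne : ∀ n, (A n : Set (V n)).Nonempty)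
    (hmap : ∀ n, ∀ x ∈ A (n + 1), f n x ∈ A n) :
    ∃ B : ∀ n, AffineSubspace k (V n), (∀ n, (B n : Set (V n)).Nonempty) ∧ (∀ n, B n ≤ A n) ∧
      ∀ n, (B (n + 1)).map (f n).toAffineMap = B n := by
  choose N hN using fun n ↦ antitone_stabilizes_of_nonempty (antitone_iteratedImage hmap n)
    fun i ↦ iteratedImage_nonempty hne i n
  refine ⟨fun n ↦ iteratedImage f A (N n) n, fun n ↦ iteratedImage_nonempty hne _ n,
    fun n ↦ antitone_iteratedImage hmap n (Nat.zero_le _), fun n ↦ ?_⟩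
  beta_reduce
  rw [← hN n (max (N n) (N (n + 1)) + 1) (by lia), ← hN (n + 1) (max (N n) (N (n + 1))) (by lia)]
  rfl

end Tower

end AffineSubspace

/-- Given a tower of finite-dimensional ℚ-vector spaces `f n : V (n+1) →ₗ[ℚ] V n` and
nonempty affine subspaces `A n ⊆ V n` with `f n` mapping `A (n+1)` into `A n`, the inverse
limit of the system `(A n, f n)` is nonempty. -/
theorem nonempty_inverseLimit_of_affineSubspaces
    (V : ℕ → Type*) [∀ n, AddCommGroup (V n)] [∀ n, Module ℚ (V n)]
    [∀ n, FiniteDimensional ℚ (V n)]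
    (f : ∀ n, V (n + 1) →ₗ[ℚ] V n)
    (A : ∀ n, AffineSubspace ℚ (V n))
    (hne : ∀ n, (A n : Set (V n)).Nonempty)
    (hmap : ∀ n, ∀ x ∈ A (n + 1), f n x ∈ A n) :
    ∃ a : ∀ n, V n, (∀ n, a n ∈ A n) ∧ ∀ n, f n (a (n + 1)) = a n := by
  obtain ⟨B, hB, hBA, hBf⟩ := AffineSubspace.exists_le_map_eq hne hmap
  have lift (n : ℕ) (x : B n) : ∃ y : B (n + 1), f n y = x := by
    obtain ⟨y, hy, hyx⟩ := (hBf n).ge x.2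
    exact ⟨⟨y, hy⟩, hyx⟩
  choose g hg using lift
  let a : ∀ n, B n := fun n ↦ Nat.rec ⟨(hB 0).some, (hB 0).some_mem⟩ g n
  exact ⟨fun n ↦ (a n).1, fun n ↦ hBA n (a n).2, fun n ↦ hg n (a n)⟩
end

section
/- Let (C,d) be a chain complex of ℚ-vector spaces equipped with a decreasing filtration C = F^1 ⊇ F^2 ⊇ ⋯ by subcomplexes such that each quotient (C/F^n)_q is finite-dimensional. Let a ∈ C_q be a cycle such that for every n there exists v_n ∈ C_{q+1} with a − d v_n ∈ F^n. Then the image of a in the completion Ĉ is a boundary: there exists a compatible sequence (b_n) with b_n ∈ (C/F^n)_{q+1}, b_{n+1} mapping to b_n under the projection C/F^{n+1} → C/F^n, and d b_n equal to the image of a in (C/F^n)_q for every n. -/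
/-!
A chain complex of ℚ-vector spaces is given by `C : ℤ → Type*` with a differential
`d q : C (q+1) →ₗ[ℚ] C q` satisfying `d ∘ d = 0`.  A decreasing filtration by subcomplexes
is `F : ℕ → ∀ q, Submodule ℚ (C q)` with `F 0 = ⊤` (so `F n` is the term `F^{n+1}` of the
filtration `C = F^1 ⊇ F^2 ⊇ ⋯`), `F (n+1) ≤ F n`, and `d (F n) ⊆ F n`.
-/

variable (C : ℤ → Type*) [∀ q, AddCommGroup (C q)] [∀ q, Module ℚ (C q)]
variable (d : ∀ q : ℤ, C (q + 1) →ₗ[ℚ] C q)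
variable (F : ℕ → ∀ q : ℤ, Submodule ℚ (C q))

/-- The projection `(C/F^{n+2})_q → (C/F^{n+1})_q`. -/
def projQ (hFmono : ∀ n q, F (n + 1) q ≤ F n q) (n : ℕ) (q : ℤ) :
    (C q ⧸ F (n + 1) q) →ₗ[ℚ] C q ⧸ F n q :=
  Submodule.mapQ _ _ LinearMap.id (by rw [Submodule.comap_id]; exact hFmono n q)

/-- The differential induced on the quotient complex `C/F^{n+1}`. -/
def dbar (hFd : ∀ n q, ∀ x ∈ F n (q + 1), d q x ∈ F n q) (n : ℕ) (q : ℤ) :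
    (C (q + 1) ⧸ F n (q + 1)) →ₗ[ℚ] C q ⧸ F n q :=
  Submodule.mapQ _ _ (d q) (fun x hx => hFd n q x hx)

/-- If `V ⧸ W` is Artinian, the images in `V ⧸ W` of a decreasing sequence of submodules are
eventually constant. -/
theorem exists_le_sup_of_antitone {R V : Type*} [Ring R] [AddCommGroup V] [Module R V]
    (W : Submodule R V) [IsArtinian R (V ⧸ W)] {K : ℕ → Submodule R V} (hK : Antitone K) (n : ℕ) :
    ∃ N, n ≤ N ∧ ∀ m, K N ≤ W ⊔ K m := by
  obtain ⟨N, hN⟩ := IsArtinian.monotone_stabilizes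
    (⟨fun m => OrderDual.toDual ((K m).map W.mkQ),
      fun _ _ h => Submodule.map_mono (hK h)⟩ : ℕ →o (Submodule R (V ⧸ W))ᵒᵈ)
  refine ⟨max n N, le_max_left _ _, fun m => ?_⟩
  have hmap : (K N).map W.mkQ = (K (max m N)).map W.mkQ := hN _ (le_max_right _ _)
  rw [← Submodule.comap_map_mkQ]
  refine (hK (le_max_right n N)).trans (Submodule.map_le_iff_le_comap.mp ?_)
  rw [hmap]
  exact Submodule.map_mono (hK (le_max_left _ _))

/-- Approximate solutions of `f v = a` modulo a decreasing sequence of submodules `G n` can be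
chosen so that consecutive ones agree modulo `W n`, provided each `V ⧸ W n` is Artinian. -/
theorem exists_compatible_approximations {R V X : Type*} [Ring R] [AddCommGroup V] [Module R V]
    [AddCommGroup X] [Module R X] (f : V →ₗ[R] X) (W : ℕ → Submodule R V)
    [∀ n, IsArtinian R (V ⧸ W n)] {G : ℕ → Submodule R X} (hG : Antitone G) (a : X)
    (h : ∀ n, ∃ v, a - f v ∈ G n) :
    ∃ u : ℕ → V, (∀ n, a - f (u n) ∈ G n) ∧ ∀ n, u (n + 1) - u n ∈ W n := by
  choose N hnN hN using fun n => exists_le_sup_of_antitone (W n)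
    (K := fun m => (G m).comap f) (fun _ _ h => Submodule.comap_mono (hG h)) n
  have step : ∀ n (u : {v // a - f v ∈ G (N n)}),
      ∃ u' : {v // a - f v ∈ G (N (n + 1))}, (u' : V) - u ∈ W n := by
    rintro n ⟨u, hu⟩
    obtain ⟨t, ht⟩ := h (max (N n) (N (n + 1)))
    have hut : u - t ∈ (G (N n)).comap f := by
      have := sub_mem (hG (le_max_left _ _) ht) hu
      rwa [sub_sub_sub_cancel_left, ← map_sub] at this
    obtain ⟨w, hw, k, hk, hwk⟩ := Submodule.mem_sup.mp (hN n (N (n + 1)) hut)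
    refine ⟨⟨t + k, ?_⟩, ?_⟩
    · rw [map_add, ← sub_sub]
      exact sub_mem (hG (le_max_right _ _) ht) hk
    · have : t + k - u = -w := by
        rw [← neg_inj, neg_sub, neg_neg, ← sub_sub, ← hwk, add_sub_cancel_right]
      exact this ▸ neg_mem hw
  choose next hnext using step
  obtain ⟨u₀, hu₀⟩ := h (N 0)
  let u : ∀ n, {v // a - f v ∈ G (N n)} := fun n => Nat.rec ⟨u₀, hu₀⟩ next n
  exact ⟨fun n => (u n).1, fun n => hG (hnN n) (u n).2, fun n => hnext n (u n)⟩

/-- Let `a` be a cycle of degree `q+1` such that for every `n` there is `v` with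
`a - d v ∈ F^{n+1}`.  Then the image of `a` in the completion is a boundary: there is a
compatible sequence `b n ∈ (C/F^{n+1})_{q+2}` with `d (b n)` equal to the image of `a`. -/
theorem image_in_completion_is_boundary
    (hdd : ∀ q : ℤ, (d q).comp (d (q + 1)) = 0)
    (hF0 : ∀ q, F 0 q = ⊤)
    (hFmono : ∀ n q, F (n + 1) q ≤ F n q)
    (hFd : ∀ n q, ∀ x ∈ F n (q + 1), d q x ∈ F n q)
    (hFfin : ∀ n q, FiniteDimensional ℚ (C q ⧸ F n q))
    (q : ℤ) (a : C (q + 1)) (ha : d q a = 0)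
    (happrox : ∀ n, ∃ v : C (q + 1 + 1), a - d (q + 1) v ∈ F n (q + 1)) :
    ∃ b : ∀ n, C (q + 1 + 1) ⧸ F n (q + 1 + 1),
      (∀ n, projQ C F hFmono n (q + 1 + 1) (b (n + 1)) = b n) ∧
      (∀ n, dbar C d F hFd n (q + 1) (b n) = Submodule.Quotient.mk a) := by
  obtain ⟨u, hu, hW⟩ := exists_compatible_approximations (d (q + 1))
    (fun n => F n (q + 1 + 1)) (G := fun n => F n (q + 1))
    (antitone_nat_of_succ_le fun n => hFmono n (q + 1)) a happrox
  refine ⟨fun n => Submodule.Quotient.mk (u n), fun n => ?_, fun n => ?_⟩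
  · exact (Submodule.Quotient.eq _).mpr (hW n)
  · exact ((Submodule.Quotient.eq _).mpr (hu n)).symm
end

section
/- Let (C,d) be a chain complex of ℚ-vector spaces equipped with a decreasing filtration C = F^1 ⊇ F^2 ⊇ ⋯ by subcomplexes such that each quotient (C/F^n)_q is finite-dimensional. Let (a_n)_{n∈ℕ} be cycles in C_q such that for each n one has a_{n+1} − a_n = z_n + d c_n with z_n ∈ (F^n)_q a cycle and c_n ∈ C_{q+1}. Then there exists a sequence (u_n) of cycles u_n ∈ (C/F^n)_q, compatible under the projections C/F^{n+1} → C/F^n, such that for each n the homology classes of u_n and of the image of a_n coincide in H_q(C/F^n). -/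
/-!
A chain complex of ℚ-vector spaces is given by `C : ℤ → Type*` with a differential
`d q : C (q+1) →ₗ[ℚ] C q` satisfying `d ∘ d = 0`.  A decreasing filtration by subcomplexes
is `F : ℕ → ∀ q, Submodule ℚ (C q)` with `F 0 = ⊤` (so `F n` is the term `F^{n+1}` of the
filtration `C = F^1 ⊇ F^2 ⊇ ⋯`), `F (n+1) ≤ F n`, and `d (F n) ⊆ F n`.
-/

variable (C : ℤ → Type*) [∀ q, AddCommGroup (C q)] [∀ q, Module ℚ (C q)]
variable (d : ∀ q : ℤ, C (q + 1) →ₗ[ℚ] C q)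
variable (F : ℕ → ∀ q : ℤ, Submodule ℚ (C q))

/-- Given cycles `a n` of degree `q+1` with `a (n+1) - a n = z + d c`, where `z ∈ F^{n+1}`
is a cycle, there is a compatible sequence of cycles `u n ∈ (C/F^{n+1})_{q+1}` whose homology
classes agree with those of the images of the `a n` in `H (C/F^{n+1})` (i.e. their difference
is a boundary in `C/F^{n+1}`). -/
theorem compatible_sequence_of_cycles
    (hdd : ∀ q : ℤ, (d q).comp (d (q + 1)) = 0)
    (hF0 : ∀ q, F 0 q = ⊤)
    (hFmono : ∀ n q, F (n + 1) q ≤ F n q)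
    (hFd : ∀ n q, ∀ x ∈ F n (q + 1), d q x ∈ F n q)
    (hFfin : ∀ n q, FiniteDimensional ℚ (C q ⧸ F n q))
    (q : ℤ) (a : ℕ → C (q + 1)) (ha : ∀ n, d q (a n) = 0)
    (hstep : ∀ n, ∃ z ∈ F n (q + 1), d q z = 0 ∧
      ∃ c : C (q + 1 + 1), a (n + 1) - a n = z + d (q + 1) c) :
    ∃ u : ∀ n, C (q + 1) ⧸ F n (q + 1),
      (∀ n, dbar C d F hFd n q (u n) = 0) ∧
      (∀ n, projQ C F hFmono n (q + 1) (u (n + 1)) = u n) ∧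
      (∀ n, u n - Submodule.Quotient.mk (a n) ∈
        LinearMap.range (dbar C d F hFd n (q + 1))) := by
  choose z hz _ c hc using hstep
  let b : ℕ → C (q + 1 + 1) := fun n => ∑ k ∈ Finset.range n, c k
  refine ⟨fun n => Submodule.Quotient.mk (a n - d (q + 1) (b n)), fun n => ?_, fun n => ?_,
    fun n => ⟨Submodule.Quotient.mk (-b n), ?_⟩⟩
  · have hddb : d q (d (q + 1) (b n)) = 0 := LinearMap.congr_fun (hdd q) (b n)
    change Submodule.Quotient.mk (d q (a n - d (q + 1) (b n))) = _
    rw [map_sub, ha, hddb, sub_zero, Submodule.Quotient.mk_zero]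
  · change Submodule.Quotient.mk (a (n + 1) - d (q + 1) (b (n + 1))) = _
    rw [Submodule.Quotient.eq]
    have hb : b (n + 1) = b n + c n := Finset.sum_range_succ c n
    have hdiff : a (n + 1) - d (q + 1) (b (n + 1)) - (a n - d (q + 1) (b n)) = z n := by
      rw [hb, map_add, sub_eq_iff_eq_add.mp (hc n)]
      abel
    rw [hdiff]
    exact hz n
  · change Submodule.Quotient.mk (d (q + 1) (-b n)) = _
    rw [← Submodule.Quotient.mk_sub, map_neg, sub_sub_cancel_left]
end

section
/- Let (C,d) be a chain complex of ℚ-vector spaces equipped with a decreasing filtration C = F^1 ⊇ F^2 ⊇ ⋯ by subcomplexes such that each quotient (C/F^n)_q is finite-dimensional, and let Ĉ be the completion. For each n let I^n ⊆ H_*(C) be the image of H_*(F^n) → H_*(C). If the canonical map H_q(C) → H_q(Ĉ) is bijective for every q, then for every q the canonical map H_q(C) → lim_n H_q(C)/I^n_q is bijective; in particular ⋂_n I^n = 0. -/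
set_option maxHeartbeats 1000000
set_option synthInstance.maxHeartbeats 400000

/-!
A chain complex of ℚ-vector spaces is given by `C : ℤ → Type*` with a differential
`d q : C (q+1) →ₗ[ℚ] C q` satisfying `d ∘ d = 0`.  A decreasing filtration by subcomplexes
is `F : ℕ → ∀ q, Submodule ℚ (C q)` with `F 0 = ⊤` (so `F n` is the term `F^{n+1}` of the
filtration `C = F^1 ⊇ F^2 ⊇ ⋯`), `F (n+1) ≤ F n`, and `d (F n) ⊆ F n`.  The completion `Ĉ`
has `Ĉ_q = lim_n (C/F^n)_q`, realized as the submodule of compatible sequences in the product,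
with the componentwise induced differential.

`Hgrp C d q` is the homology of the complex in degree `q+1`: cycles modulo boundaries.
`Hmap` is the map on homology induced by the canonical chain map `C → Ĉ`, and
`Isub n q` is the image of `H(F^{n+1}) → H(C)` in degree `q+1`.
-/

theorem exists_seq_of_forall_step {α : Type*} {Q : ℕ → α → Prop} {R : ℕ → α → α → Prop}
    (h0 : ∃ a, Q 0 a) (hstep : ∀ n a, Q n a → ∃ b, Q (n + 1) b ∧ R n a b) :
    ∃ f : ℕ → α, ∀ n, Q n (f n) ∧ R n (f n) (f (n + 1)) := by
  obtain ⟨a, ha⟩ := h0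
  choose! g hgQ hgR using hstep
  let f : ℕ → α := fun n => Nat.rec a g n
  have hf : ∀ n, Q n (f n) := by
    intro n
    induction n with
    | zero => exact ha
    | succ n ih => exact hgQ n _ ih
  exact ⟨f, fun n => ⟨hf n, hgR n _ (hf n)⟩⟩

/-- A decreasing sequence of submodules stabilizes modulo a submodule with Artinian quotient. -/
theorem exists_forall_le_sup_of_antitone {K V : Type*} [Ring K] [AddCommGroup V] [Module K V]
    {P : ℕ → Submodule K V} (hP : Antitone P) (G : Submodule K V) [IsArtinian K (V ⧸ G)] :
    ∃ N, ∀ m, P N ≤ P m ⊔ G := by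
  obtain ⟨N, hN⟩ := IsArtinian.monotone_stabilizes
    (⟨fun m => OrderDual.toDual ((P m).map G.mkQ), fun _ _ h => Submodule.map_mono (hP h)⟩ :
      ℕ →o (Submodule K (V ⧸ G))ᵒᵈ)
  refine ⟨N, fun m => ?_⟩
  rcases le_total N m with h | h
  · have h' : (P N).map G.mkQ = (P m).map G.mkQ := congrArg OrderDual.ofDual (hN m h)
    rw [sup_comm, ← Submodule.comap_map_mkQ, ← h']
    exact Submodule.le_comap_map _ _
  · exact (hP h).trans le_sup_left

/-- If `φ y = x` is solvable modulo every `F n`, it has approximate solutions which are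
compatible modulo the submodules `G n`, provided these have Artinian quotients. -/
theorem exists_compatible_seq_sub_mem {K V W : Type*} [Ring K] [AddCommGroup V] [Module K V]
    [AddCommGroup W] [Module K W] (φ : V →ₗ[K] W) {G : ℕ → Submodule K V}
    {F : ℕ → Submodule K W} (hF : Antitone F) (hGF : ∀ n, G n ≤ (F n).comap φ)
    (hG : ∀ n, IsArtinian K (V ⧸ G n)) {x : W} (hx : ∀ n, ∃ y, x - φ y ∈ F n) :
    ∃ y : ℕ → V, ∀ n, x - φ (y n) ∈ F n ∧ y (n + 1) - y n ∈ G n := by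
  have hstable : ∀ n, ∃ N, ∀ s, x - φ s ∈ F N → ∀ m, ∃ t, x - φ t ∈ F m ∧ s - t ∈ G n := by
    intro n
    have := hG n
    obtain ⟨N, hN⟩ := exists_forall_le_sup_of_antitone
      (P := fun m => (F m).comap φ) (fun _ _ h => Submodule.comap_mono (hF h)) (G n)
    refine ⟨N, fun s hs m => ?_⟩
    obtain ⟨t, ht⟩ := hx (max m N)
    have hst : s - t ∈ (F N).comap φ := by
      have := (F N).sub_mem (hF (le_max_right m N) ht) hs
      rwa [sub_sub_sub_cancel_left, ← map_sub] at this
    obtain ⟨p, hp, g, hg, hpg⟩ := Submodule.mem_sup.mp (hN m hst)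
    refine ⟨t + p, ?_, ?_⟩
    · rw [map_add, ← sub_sub]
      exact (F m).sub_mem (hF (le_max_left m N) ht) hp
    · rwa [← sub_sub, ← hpg, add_sub_cancel_left]
  obtain ⟨y, hy⟩ := exists_seq_of_forall_step
    (Q := fun n s => ∀ m, ∃ t, x - φ t ∈ F m ∧ s - t ∈ G n)
    (R := fun n s s' => s' - s ∈ G n)
    (by
      obtain ⟨N, hN⟩ := hstable 0
      obtain ⟨s, hs⟩ := hx N
      exact ⟨s, hN s hs⟩)
    (by
      intro n s hs
      obtain ⟨N, hN⟩ := hstable (n + 1)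
      obtain ⟨t, ht, hst⟩ := hs N
      exact ⟨t, hN t ht, by simpa using (G n).neg_mem hst⟩)
  refine ⟨y, fun n => ⟨?_, (hy n).2⟩⟩
  obtain ⟨t, ht, hyt⟩ := (hy n).1 n
  have := (F n).sub_mem ht (hGF n hyt)
  rwa [map_sub, sub_sub, add_sub_cancel] at this

section ChainComplex

variable (C : ℤ → Type*) [∀ q, AddCommGroup (C q)] [∀ q, Module ℚ (C q)]
variable (d : ∀ q : ℤ, C (q + 1) →ₗ[ℚ] C q)
variable (F : ℕ → ∀ q : ℤ, Submodule ℚ (C q))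

/-- The cycles of degree `q+1`. -/
abbrev cyc (q : ℤ) : Submodule ℚ (C (q + 1)) := LinearMap.ker (d q)

/-- The boundaries of degree `q+1`, viewed inside the cycles. -/
abbrev bdry (q : ℤ) : Submodule ℚ ↥(cyc C d q) :=
  (LinearMap.range (d (q + 1))).comap (cyc C d q).subtype

/-- The homology of the complex `(C, d)` in degree `q+1`. -/
abbrev Hgrp (q : ℤ) := ↥(cyc C d q) ⧸ bdry C d q

lemma projQ_mk (hFmono : ∀ n q, F (n + 1) q ≤ F n q) (n : ℕ) (q : ℤ) (x : C q) :
    projQ C F hFmono n q (Submodule.Quotient.mk x) = Submodule.Quotient.mk x := by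
  simp only [projQ, Submodule.mapQ_apply, LinearMap.id_apply]

lemma dbar_mk (hFd : ∀ n q, ∀ x ∈ F n (q + 1), d q x ∈ F n q) (n : ℕ) (q : ℤ)
    (x : C (q + 1)) :
    dbar C d F hFd n q (Submodule.Quotient.mk x) = Submodule.Quotient.mk (d q x) := by
  simp only [dbar, Submodule.mapQ_apply]

lemma projQ_comp_dbar (hFmono : ∀ n q, F (n + 1) q ≤ F n q)
    (hFd : ∀ n q, ∀ x ∈ F n (q + 1), d q x ∈ F n q) (n : ℕ) (q : ℤ) :
    (projQ C F hFmono n q).comp (dbar C d F hFd (n + 1) q)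
      = (dbar C d F hFd n q).comp (projQ C F hFmono n (q + 1)) := by
  refine Submodule.linearMap_qext _ ?_
  ext x
  simp only [LinearMap.comp_apply, Submodule.mkQ_apply, projQ_mk, dbar_mk]

/-- The degree-`q` part `Ĉ_q = lim_n (C/F^n)_q` of the completion, realized as the
submodule of compatible sequences in `Π_n (C/F^n)_q`. -/
def compatSub (hFmono : ∀ n q, F (n + 1) q ≤ F n q) (q : ℤ) :
    Submodule ℚ (∀ n, C q ⧸ F n q) where
  carrier := {f | ∀ n, projQ C F hFmono n q (f (n + 1)) = f n}
  add_mem' := by intro f g hf hg n; simp only [Pi.add_apply, map_add, hf n, hg n]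
  zero_mem' := by intro n; simp
  smul_mem' := by intro c f hf n; simp only [Pi.smul_apply, map_smul, hf n]

lemma mem_compatSub (hFmono : ∀ n q, F (n + 1) q ≤ F n q) (q : ℤ)
    (f : ∀ n, C q ⧸ F n q) :
    f ∈ compatSub C F hFmono q ↔ ∀ n, projQ C F hFmono n q (f (n + 1)) = f n :=
  Iff.rfl

/-- The componentwise differential of the completion `Ĉ`. -/
def dhat (hFmono : ∀ n q, F (n + 1) q ≤ F n q)
    (hFd : ∀ n q, ∀ x ∈ F n (q + 1), d q x ∈ F n q) (q : ℤ) :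
    ↥(compatSub C F hFmono (q + 1)) →ₗ[ℚ] ↥(compatSub C F hFmono q) :=
  LinearMap.codRestrict (compatSub C F hFmono q)
    ((LinearMap.pi fun n => (dbar C d F hFd n q).comp (LinearMap.proj n)).comp
      (compatSub C F hFmono (q + 1)).subtype)
    (by
      intro f
      rw [mem_compatSub]
      intro n
      have h := congrArg
        (fun φ : (C (q + 1) ⧸ F (n + 1) (q + 1)) →ₗ[ℚ] C q ⧸ F n q => φ (f.1 (n + 1)))
        (projQ_comp_dbar C d F hFmono hFd n q)
      simp only [LinearMap.comp_apply] at h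
      have h2 := (mem_compatSub C F hFmono (q + 1) f.1).mp f.2 n
      show projQ C F hFmono n q (dbar C d F hFd (n + 1) q (f.1 (n + 1)))
        = dbar C d F hFd n q (f.1 n)
      rw [h, h2])

lemma dhat_coe (hFmono : ∀ n q, F (n + 1) q ≤ F n q)
    (hFd : ∀ n q, ∀ x ∈ F n (q + 1), d q x ∈ F n q) (q : ℤ)
    (f : ↥(compatSub C F hFmono (q + 1))) (n : ℕ) :
    (dhat C d F hFmono hFd q f).1 n = dbar C d F hFd n q (f.1 n) :=
  rfl

/-- The canonical chain map `C → Ĉ`. -/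
def toChat (hFmono : ∀ n q, F (n + 1) q ≤ F n q) (q : ℤ) :
    C q →ₗ[ℚ] ↥(compatSub C F hFmono q) :=
  LinearMap.codRestrict (compatSub C F hFmono q)
    (LinearMap.pi fun n => (F n q).mkQ)
    (by
      intro x
      rw [mem_compatSub]
      intro n
      show projQ C F hFmono n q (Submodule.Quotient.mk x) = Submodule.Quotient.mk x
      exact projQ_mk C F hFmono n q x)

lemma toChat_coe (hFmono : ∀ n q, F (n + 1) q ≤ F n q) (q : ℤ) (x : C q) (n : ℕ) :
    (toChat C F hFmono q x).1 n = Submodule.Quotient.mk x :=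
  rfl

/-- The canonical chain map `C → Ĉ` sends cycles to cycles. -/
def cycToChat (hFmono : ∀ n q, F (n + 1) q ≤ F n q)
    (hFd : ∀ n q, ∀ x ∈ F n (q + 1), d q x ∈ F n q) (q : ℤ) :
    ↥(cyc C d q) →ₗ[ℚ]
      ↥(cyc (fun q => ↥(compatSub C F hFmono q)) (dhat C d F hFmono hFd) q) :=
  (toChat C F hFmono (q + 1)).restrict (fun x hx => by
    rw [LinearMap.mem_ker] at hx ⊢
    apply Subtype.ext
    funext n
    rw [dhat_coe, toChat_coe, dbar_mk, hx]
    rw [Submodule.Quotient.mk_zero]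
    rfl)

/-- The map `H_q(C) → H_q(Ĉ)` induced by the canonical chain map `C → Ĉ`. -/
def Hmap (hFmono : ∀ n q, F (n + 1) q ≤ F n q)
    (hFd : ∀ n q, ∀ x ∈ F n (q + 1), d q x ∈ F n q) (q : ℤ) :
    Hgrp C d q →ₗ[ℚ]
      Hgrp (fun q => ↥(compatSub C F hFmono q)) (dhat C d F hFmono hFd) q :=
  Submodule.mapQ _ _ (cycToChat C d F hFmono hFd q) (by
    intro x hx
    rw [Submodule.mem_comap] at hx
    rw [Submodule.mem_comap, Submodule.mem_comap, LinearMap.mem_range] at *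
    obtain ⟨v, hv⟩ := hx
    refine ⟨toChat C F hFmono (q + 1 + 1) v, ?_⟩
    apply Subtype.ext
    funext n
    rw [dhat_coe, toChat_coe, dbar_mk, hv]
    rfl)

/-- `Isub n q`: the image of `H(F^{n+1}) → H(C)` in degree `q+1`, i.e. the submodule of
`Hgrp C d q` of classes represented by cycles lying in `F^{n+1}`. -/
def Isub (n : ℕ) (q : ℤ) : Submodule ℚ (Hgrp C d q) :=
  Submodule.map (bdry C d q).mkQ ((F n (q + 1)).comap (cyc C d q).subtype)

lemma Isub_antitone (hFmono : ∀ n q, F (n + 1) q ≤ F n q) (n : ℕ) (q : ℤ) :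
    Isub C d F (n + 1) q ≤ Isub C d F n q :=
  Submodule.map_mono (Submodule.comap_mono (hFmono n (q + 1)))

/-- The projection `H_q(C)/I^{n+2} → H_q(C)/I^{n+1}`. -/
def projH (hFmono : ∀ n q, F (n + 1) q ≤ F n q) (n : ℕ) (q : ℤ) :
    (Hgrp C d q ⧸ Isub C d F (n + 1) q) →ₗ[ℚ] Hgrp C d q ⧸ Isub C d F n q :=
  Submodule.mapQ _ _ LinearMap.id
    (by rw [Submodule.comap_id]; exact Isub_antitone C d F hFmono n q)

/-- The inverse limit `lim_n H_q(C)/I^n`, realized as the submodule of compatible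
sequences in the product. -/
def limH (hFmono : ∀ n q, F (n + 1) q ≤ F n q) (q : ℤ) :
    Submodule ℚ (∀ n, Hgrp C d q ⧸ Isub C d F n q) where
  carrier := {f | ∀ n, projH C d F hFmono n q (f (n + 1)) = f n}
  add_mem' := by intro f g hf hg n; simp only [Pi.add_apply, map_add, hf n, hg n]
  zero_mem' := by intro n; simp
  smul_mem' := by intro c f hf n; simp only [Pi.smul_apply, map_smul, hf n]

/-- The canonical map `H_q(C) → lim_n H_q(C)/I^n`. -/
def toLimH (hFmono : ∀ n q, F (n + 1) q ≤ F n q) (q : ℤ) (x : Hgrp C d q) :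
    ↥(limH C d F hFmono q) :=
  ⟨fun n => Submodule.Quotient.mk x, by
    intro n
    simp only [projH, Submodule.mapQ_apply, LinearMap.id_apply]⟩

/-- The element of the completion given by a sequence with `y (n+1) - y n ∈ F n`. -/
def chatOfSeq (hFmono : ∀ n q, F (n + 1) q ≤ F n q) (q : ℤ) (y : ℕ → C q)
    (hy : ∀ n, y (n + 1) - y n ∈ F n q) : ↥(compatSub C F hFmono q) :=
  ⟨fun n => Submodule.Quotient.mk (y n), fun n => by
    rw [projQ_mk]
    exact (Submodule.Quotient.eq _).mpr (hy n)⟩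

lemma mk_mem_Isub_iff
    (hdd : ∀ q : ℤ, (d q).comp (d (q + 1)) = 0) (n : ℕ) (q : ℤ) (x : ↥(cyc C d q)) :
    (bdry C d q).mkQ x ∈ Isub C d F n q ↔ ∃ y, x.1 - d (q + 1) y ∈ F n (q + 1) := by
  rw [Isub, Submodule.mem_map]
  constructor
  · rintro ⟨z, hz, hzx⟩
    obtain ⟨y, hy⟩ := (Submodule.Quotient.eq _).mp hzx.symm
    refine ⟨y, ?_⟩
    rw [hy]
    simpa using hz
  · rintro ⟨y, hy⟩
    have hdy : d q (d (q + 1) y) = 0 := LinearMap.congr_fun (hdd q) y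
    refine ⟨x - ⟨d (q + 1) y, hdy⟩, hy, (Submodule.Quotient.eq _).mpr ⟨-y, ?_⟩⟩
    simp

lemma iInf_Isub_eq_bot (hdd : ∀ q : ℤ, (d q).comp (d (q + 1)) = 0)
    (hFmono : ∀ n q, F (n + 1) q ≤ F n q)
    (hFd : ∀ n q, ∀ x ∈ F n (q + 1), d q x ∈ F n q)
    (hFfin : ∀ n q, FiniteDimensional ℚ (C q ⧸ F n q)) (q : ℤ)
    (hinj : Function.Injective (Hmap C d F hFmono hFd q)) :
    (⨅ n, Isub C d F n q) = ⊥ := by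
  rw [eq_bot_iff]
  intro ξ hξ
  obtain ⟨x, rfl⟩ := Submodule.mkQ_surjective _ ξ
  have hx := fun n => (mk_mem_Isub_iff C d F hdd n q x).mp ((Submodule.mem_iInf _).mp hξ n)
  obtain ⟨y, hy⟩ := exists_compatible_seq_sub_mem (d (q + 1))
    (G := fun n => F n (q + 1 + 1)) (F := fun n => F n (q + 1))
    (antitone_nat_of_succ_le fun n => hFmono n _) (fun n z hz => hFd n _ z hz)
    (fun n => have := hFfin n (q + 1 + 1); inferInstance) hx
  refine (Submodule.mem_bot ℚ).mpr (hinj ?_)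
  rw [map_zero]
  refine (Submodule.Quotient.mk_eq_zero _).mpr
    ⟨chatOfSeq C F hFmono _ y fun n => (hy n).2, Subtype.ext (funext fun n => ?_)⟩
  exact ((Submodule.Quotient.eq _).mpr (hy n).1).symm

lemma exists_cyc_seq_of_mem_limH (hdd : ∀ q : ℤ, (d q).comp (d (q + 1)) = 0)
    (hFmono : ∀ n q, F (n + 1) q ≤ F n q) (q : ℤ) (f : ↥(limH C d F hFmono q)) :
    ∃ z : ℕ → ↥(cyc C d q), ∀ n,
      f.1 n = (Isub C d F n q).mkQ ((bdry C d q).mkQ (z n)) ∧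
      (z (n + 1)).1 - (z n).1 ∈ F n (q + 1) := by
  have hlift : ∀ n, ∃ z : ↥(cyc C d q),
      f.1 n = (Isub C d F n q).mkQ ((bdry C d q).mkQ z) := by
    intro n
    obtain ⟨ξ, hξ⟩ := Submodule.mkQ_surjective _ (f.1 n)
    obtain ⟨z, rfl⟩ := Submodule.mkQ_surjective _ ξ
    exact ⟨z, hξ.symm⟩
  refine exists_seq_of_forall_step
    (Q := fun n z => f.1 n = (Isub C d F n q).mkQ ((bdry C d q).mkQ z))
    (R := fun n z z' => z'.1 - z.1 ∈ F n (q + 1)) (hlift 0) fun n z hz => ?_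
  obtain ⟨w, hw⟩ := hlift (n + 1)
  have hwz : (Isub C d F n q).mkQ ((bdry C d q).mkQ w)
      = (Isub C d F n q).mkQ ((bdry C d q).mkQ z) := by
    have h := f.2 n
    rw [hw, hz] at h
    exact h
  have hmem := (Submodule.Quotient.eq _).mp hwz
  rw [← map_sub, mk_mem_Isub_iff C d F hdd] at hmem
  obtain ⟨y, hy⟩ := hmem
  have hdy : d q (d (q + 1) y) = 0 := LinearMap.congr_fun (hdd q) y
  refine ⟨w - ⟨d (q + 1) y, hdy⟩, ?_, ?_⟩
  · rw [hw]
    congr 1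
    refine (Submodule.Quotient.eq _).mpr ⟨y, ?_⟩
    simp
  · have h : w.1 - d (q + 1) y - z.1 = (w - z).1 - d (q + 1) y := sub_right_comm _ _ _
    exact h ▸ hy

lemma toLimH_surjective (hdd : ∀ q : ℤ, (d q).comp (d (q + 1)) = 0)
    (hFmono : ∀ n q, F (n + 1) q ≤ F n q)
    (hFd : ∀ n q, ∀ x ∈ F n (q + 1), d q x ∈ F n q) (q : ℤ)
    (hsurj : Function.Surjective (Hmap C d F hFmono hFd q)) :
    Function.Surjective (toLimH C d F hFmono q) := by
  intro f
  obtain ⟨z, hz⟩ := exists_cyc_seq_of_mem_limH C d F hdd hFmono q f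
  let c := chatOfSeq C F hFmono (q + 1) (fun n => (z n).1) fun n => (hz n).2
  have hc : dhat C d F hFmono hFd q c = 0 := by
    refine Subtype.ext (funext fun n => ?_)
    change Submodule.Quotient.mk (d q (z n).1) = 0
    rw [LinearMap.mem_ker.mp (z n).2, Submodule.Quotient.mk_zero]
  obtain ⟨ξ, hξ⟩ := hsurj (Submodule.Quotient.mk ⟨c, hc⟩)
  obtain ⟨x, rfl⟩ := Submodule.mkQ_surjective _ ξ
  obtain ⟨y, hy⟩ := (Submodule.Quotient.eq _).mp hξ
  refine ⟨(bdry C d q).mkQ x, Subtype.ext (funext fun n => ?_)⟩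
  rw [(hz n).1]
  refine (Submodule.Quotient.eq _).mpr ?_
  rw [← map_sub, mk_mem_Isub_iff C d F hdd]
  obtain ⟨v, hv⟩ := Submodule.mkQ_surjective _ (y.1 n)
  refine ⟨v, (Submodule.Quotient.eq _).mp ?_⟩
  have h : dbar C d F hFd n (q + 1) (y.1 n) = Submodule.Quotient.mk (x.1 - (z n).1) :=
    congrFun (congrArg Subtype.val hy) n
  rw [← hv] at h
  exact h.symm

/-- If the canonical map `H_q(C) → H_q(Ĉ)` is bijective for every `q`, then the canonical
map `H_q(C) → lim_n H_q(C)/I^n` is bijective for every `q`; in particular `⋂_n I^n = 0`. -/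
theorem bijective_toLimH_of_bijective_Hmap
    (hdd : ∀ q : ℤ, (d q).comp (d (q + 1)) = 0)
    (hF0 : ∀ q, F 0 q = ⊤)
    (hFmono : ∀ n q, F (n + 1) q ≤ F n q)
    (hFd : ∀ n q, ∀ x ∈ F n (q + 1), d q x ∈ F n q)
    (hFfin : ∀ n q, FiniteDimensional ℚ (C q ⧸ F n q))
    (hbij : ∀ q, Function.Bijective (Hmap C d F hFmono hFd q)) :
    ∀ q, Function.Bijective (toLimH C d F hFmono q) ∧ (⨅ n, Isub C d F n q) = ⊥ := by
  intro q
  have hbot := iInf_Isub_eq_bot C d F hdd hFmono hFd hFfin q (hbij q).1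
  refine ⟨⟨fun ξ η h => ?_, toLimH_surjective C d F hdd hFmono hFd q (hbij q).2⟩, hbot⟩
  rw [← sub_eq_zero, ← Submodule.mem_bot ℚ, ← hbot, Submodule.mem_iInf]
  exact fun n => (Submodule.Quotient.eq _).mp (congrFun (congrArg Subtype.val h) n)

end ChainComplex
end

section
/- Let (C,d) be a chain complex of ℚ-vector spaces such that each C_q has countable dimension over ℚ, equipped with a decreasing filtration C = F^1 ⊇ F^2 ⊇ ⋯ by subcomplexes such that each quotient (C/F^n)_q is finite-dimensional, and let Ĉ be the completion. For each n let I^n ⊆ H_*(C) be the image of H_*(F^n) → H_*(C). If the canonical map H_q(C) → H_q(Ĉ) is bijective for every q, then for every q the homology H_q(C) is finite-dimensional and there exists an integer n(q) with I^{n(q)}_q = 0. -/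
set_option maxHeartbeats 1000000
set_option synthInstance.maxHeartbeats 400000

/-!
A chain complex of ℚ-vector spaces is given by `C : ℤ → Type*` with a differential
`d q : C (q+1) →ₗ[ℚ] C q` satisfying `d ∘ d = 0`.  A decreasing filtration by subcomplexes
is `F : ℕ → ∀ q, Submodule ℚ (C q)` with `F 0 = ⊤` (so `F n` is the term `F^{n+1}` of the
filtration `C = F^1 ⊇ F^2 ⊇ ⋯`), `F (n+1) ≤ F n`, and `d (F n) ⊆ F n`.  The completion `Ĉ`
has `Ĉ_q = lim_n (C/F^n)_q`, realized as the submodule of compatible sequences in the product,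
with the componentwise induced differential.

`Hgrp C d q` is the homology of the complex in degree `q+1`: cycles modulo boundaries.
`Hmap` is the map on homology induced by the canonical chain map `C → Ĉ`, and
`Isub n q` is the image of `H(F^{n+1}) → H(C)` in degree `q+1`.
-/

section ChainComplex

variable (C : ℤ → Type*) [∀ q, AddCommGroup (C q)] [∀ q, Module ℚ (C q)]
variable (d : ∀ q : ℤ, C (q + 1) →ₗ[ℚ] C q)
variable (F : ℕ → ∀ q : ℤ, Submodule ℚ (C q))

/-- A module over a countable ring which is free of countable rank is countable. -/
lemma countable_of_rank_le_aleph0 {R M : Type*} [Ring R] [StrongRankCondition R] [Countable R]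
    [AddCommGroup M] [Module R M] [Module.Free R M]
    (h : Module.rank R M ≤ Cardinal.aleph0) : Countable M := by
  have b := Module.Free.chooseBasis R M
  have : Countable (Module.Free.ChooseBasisIndex R M) := by
    rw [← Cardinal.mk_le_aleph0_iff]
    simpa [Module.Free.rank_eq_card_chooseBasisIndex] using h
  exact b.repr.toEquiv.countable_iff.mpr inferInstance

/-- Mittag-Leffler: if the equation `f v = z` is solvable modulo each step of the filtration and
the quotients of the source are Artinian, then there is a compatible system of solutions. -/
lemma exists_compatible_approx_preimage {R V W : Type*} [Ring R] [AddCommGroup V] [Module R V]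
    [AddCommGroup W] [Module R W] (f : V →ₗ[R] W) {G : ℕ → Submodule R V}
    {G' : ℕ → Submodule R W} (hG0 : G 0 = ⊤) (hG' : Antitone G')
    (hf : ∀ n, ∀ x ∈ G n, f x ∈ G' n) (hfin : ∀ n, IsArtinian R (V ⧸ G n)) (z : W)
    (hz : ∀ n, ∃ v, f v - z ∈ G' n) :
    ∃ w : ℕ → V, ∀ n, w (n + 1) - w n ∈ G n ∧ f (w n) - z ∈ G' n := by
  let Good (n : ℕ) (w : V) : Prop := ∀ j, ∃ w', f w' - z ∈ G' j ∧ w' - w ∈ G n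
  have good_zero : Good 0 0 := fun j => by
    obtain ⟨v, hv⟩ := hz j
    exact ⟨v, hv, by simp [hG0]⟩
  have good_succ : ∀ n w, Good n w → ∃ w', Good (n + 1) w' ∧ w' - w ∈ G n := by
    intro n w hw
    obtain ⟨N, hN⟩ := IsArtinian.monotone_stabilizes (R := R) (M := V ⧸ G (n + 1))
      ⟨fun m => OrderDual.toDual (((G' m).comap f).map (G (n + 1)).mkQ),
        fun a b hab => Submodule.map_mono (Submodule.comap_mono (hG' hab))⟩
    obtain ⟨w', hw', hww'⟩ := hw N
    refine ⟨w', fun j => ?_, hww'⟩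
    obtain hj | hj := le_total j N
    · exact ⟨w', hG' hj hw', by simp⟩
    obtain ⟨v, hv⟩ := hz j
    have hmem : (G (n + 1)).mkQ (w' - v) ∈ ((G' N).comap f).map (G (n + 1)).mkQ := by
      refine Submodule.mem_map_of_mem ?_
      rw [Submodule.mem_comap, map_sub, ← sub_sub_sub_cancel_right _ _ z]
      exact sub_mem hw' (hG' hj hv)
    have hNj : ((G' N).comap f).map (G (n + 1)).mkQ = ((G' j).comap f).map (G (n + 1)).mkQ :=
      hN j hj
    rw [hNj] at hmem
    obtain ⟨k, hk, hkv⟩ := hmem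
    refine ⟨v + k, ?_, ?_⟩
    · rw [map_add, add_sub_right_comm]
      exact add_mem hv hk
    · have := (Submodule.Quotient.eq _).mp hkv
      rwa [sub_sub_eq_add_sub, add_comm k v] at this
  choose! next hnext using good_succ
  let w : ℕ → V := fun n => Nat.rec 0 next n
  have hgood : ∀ n, Good n (w n) := fun n => by
    induction n with
    | zero => exact good_zero
    | succ n ih => exact (hnext n _ ih).1
  refine ⟨w, fun n => ⟨(hnext n _ (hgood n)).2, ?_⟩⟩
  obtain ⟨w', hw', hww'⟩ := hgood n n
  have := sub_mem hw' (hf n _ hww')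
  rwa [map_sub, sub_sub_sub_cancel_left] at this

/-- A Baire-type argument: in a countable filtered module, if `B` is closed relative to `Z`
and every Cauchy sequence in `Z` converges modulo `B`, then `B` is open relative to `Z`. -/
lemma exists_inf_le_of_countable_of_complete {R V : Type*} [Ring R] [AddCommGroup V] [Module R V]
    [Countable V] {G : ℕ → Submodule R V} (hG : Antitone G) (Z B : Submodule R V)
    (hsep : ∀ z ∈ Z, (∀ n, z ∈ B ⊔ G n) → z ∈ B)
    (hcomplete : ∀ s : ℕ → V, (∀ n, s n ∈ Z) → (∀ n, s (n + 1) - s n ∈ G n) →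
      ∃ z, ∀ n, s n - z ∈ B ⊔ G n) :
    ∃ n, Z ⊓ G n ≤ B := by
  classical
  by_contra! hne
  have hstep : ∀ n, ∃ z ∈ Z, z ∈ G n ∧ ∃ m, z ∉ B ⊔ G m := by
    intro n
    obtain ⟨z, hz, hzB⟩ := SetLike.not_le_iff_exists.mp (hne n)
    refine ⟨z, hz.1, hz.2, ?_⟩
    by_contra! h
    exact hzB (hsep z hz.1 h)
  choose y hyZ hyG next hnext using hstep
  have lt_next : ∀ n, n < next n := fun n => by
    by_contra! h
    exact hnext n (Submodule.mem_sup_right (hG h (hyG n)))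
  let a : ℕ → ℕ := fun k => Nat.rec 0 (fun _ => next) k
  have ha : StrictMono a := strictMono_nat_of_lt_succ fun k => lt_next (a k)
  let s (S : Set ℕ) (n : ℕ) : V := ∑ k ∈ Finset.range n, if k ∈ S then y (a k) else 0
  have hs : ∀ S, ∃ z, ∀ n, s S n - z ∈ B ⊔ G n := by
    intro S
    refine hcomplete (s S) (fun n => sum_mem fun k _ => ?_) fun n => ?_
    · split_ifs
      exacts [hyZ _, zero_mem _]
    · simp only [s, Finset.sum_range_succ, add_sub_cancel_left]
      split_ifs
      exacts [hG (ha.le_apply) (hyG _), zero_mem _]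
  choose lim hlim using hs
  have hinj : Function.Injective lim := by
    intro S T hST
    by_contra hne
    have hex : ∃ k, ¬ (k ∈ S ↔ k ∈ T) := by
      by_contra! h
      exact hne (Set.ext h)
    let k := Nat.find hex
    have hk : ¬ (k ∈ S ↔ k ∈ T) := Nat.find_spec hex
    have hlt : ∀ j < k, (j ∈ S ↔ j ∈ T) := fun j hj => not_not.mp (Nat.find_min hex hj)
    have hdiff : s S (a (k + 1)) - s T (a (k + 1)) ∈ B ⊔ G (a (k + 1)) := by
      have := sub_mem (hlim S (a (k + 1))) (hlim T (a (k + 1)))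
      rwa [hST, sub_sub_sub_cancel_right] at this
    let t (j : ℕ) : V := (if j ∈ S then y (a j) else 0) - if j ∈ T then y (a j) else 0
    have hsum : s S (a (k + 1)) - s T (a (k + 1)) = ∑ j ∈ Finset.range (a (k + 1)), t j :=
      (Finset.sum_sub_distrib _ _).symm
    have hkmem : k ∈ Finset.range (a (k + 1)) := Finset.mem_range.mpr ha.le_apply
    rw [hsum, ← Finset.add_sum_erase _ _ hkmem] at hdiff
    have hrest : ∑ j ∈ (Finset.range (a (k + 1))).erase k, t j ∈ B ⊔ G (a (k + 1)) := by
      refine sum_mem fun j hj => ?_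
      obtain hjk | hjk := lt_or_gt_of_ne (Finset.ne_of_mem_erase hj)
      · simp [t, hlt j hjk]
      · have hy : y (a j) ∈ G (a (k + 1)) := hG (ha.monotone hjk) (hyG _)
        refine Submodule.mem_sup_right (sub_mem ?_ ?_) <;> split_ifs <;> simp [hy]
    have htk : t k ∈ B ⊔ G (a (k + 1)) := (Submodule.add_mem_iff_left _ hrest).mp hdiff
    apply hnext (a k)
    change y (a k) ∈ B ⊔ G (a (k + 1))
    by_cases hS : k ∈ S <;> by_cases hT : k ∈ T <;> simp_all [t]
  obtain ⟨g, hg⟩ := Countable.exists_injective_nat V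
  exact Function.cantor_injective _ (hg.comp hinj)

lemma exists_eq_d_of_Hmap_injective (hFmono : ∀ n q, F (n + 1) q ≤ F n q)
    (hFd : ∀ n q, ∀ x ∈ F n (q + 1), d q x ∈ F n q) (q : ℤ)
    (hinj : Function.Injective (Hmap C d F hFmono hFd q)) {z : C (q + 1)} (hz : d q z = 0)
    {w : ℕ → C (q + 1 + 1)} (hw : ∀ n, w (n + 1) - w n ∈ F n (q + 1 + 1))
    (hwz : ∀ n, d (q + 1) (w n) - z ∈ F n (q + 1)) :
    z ∈ LinearMap.range (d (q + 1)) := by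
  let zc : ↥(cyc C d q) := ⟨z, hz⟩
  let wh : ↥(compatSub C F hFmono (q + 1 + 1)) :=
    ⟨fun n => Submodule.Quotient.mk (w n), fun n => by
      rw [projQ_mk]
      exact (Submodule.Quotient.eq _).mpr (hw n)⟩
  have h0 : Hmap C d F hFmono hFd q ((bdry C d q).mkQ zc) = 0 := by
    refine (Submodule.Quotient.mk_eq_zero _).mpr ⟨wh, ?_⟩
    apply Subtype.ext
    funext n
    rw [dhat_coe]
    change dbar C d F hFd n (q + 1) (Submodule.Quotient.mk (w n)) = Submodule.Quotient.mk z
    rw [dbar_mk]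
    exact (Submodule.Quotient.eq _).mpr (hwz n)
  exact (Submodule.Quotient.mk_eq_zero (bdry C d q) (x := zc)).mp (hinj (h0.trans (map_zero _).symm))

lemma exists_limit_of_Hmap_surjective (hFmono : ∀ n q, F (n + 1) q ≤ F n q)
    (hFd : ∀ n q, ∀ x ∈ F n (q + 1), d q x ∈ F n q) (q : ℤ)
    (hsurj : Function.Surjective (Hmap C d F hFmono hFd q)) {s : ℕ → C (q + 1)}
    (hs : ∀ n, d q (s n) = 0) (hsF : ∀ n, s (n + 1) - s n ∈ F n (q + 1)) :
    ∃ z, ∀ n, s n - z ∈ LinearMap.range (d (q + 1)) ⊔ F n (q + 1) := by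
  let sh : ↥(compatSub C F hFmono (q + 1)) :=
    ⟨fun n => Submodule.Quotient.mk (s n), fun n => by
      rw [projQ_mk]
      exact (Submodule.Quotient.eq _).mpr (hsF n)⟩
  have hsh : dhat C d F hFmono hFd q sh = 0 := by
    apply Subtype.ext
    funext n
    rw [dhat_coe]
    change dbar C d F hFd n q (Submodule.Quotient.mk (s n)) = 0
    rw [dbar_mk, hs, Submodule.Quotient.mk_zero]
  obtain ⟨c, hc⟩ := hsurj (Submodule.Quotient.mk ⟨sh, hsh⟩)
  obtain ⟨z, rfl⟩ := Submodule.Quotient.mk_surjective _ c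
  obtain ⟨wh, hwh⟩ := (Submodule.Quotient.eq _).mp hc.symm
  refine ⟨z.1, fun n => ?_⟩
  have hn : dbar C d F hFd n (q + 1) (wh.1 n) = Submodule.Quotient.mk (s n - z.1) :=
    congrFun (congrArg Subtype.val hwh) n
  obtain ⟨w, hw⟩ := Submodule.Quotient.mk_surjective _ (wh.1 n)
  rw [← hw, dbar_mk, eq_comm, Submodule.Quotient.eq] at hn
  exact Submodule.mem_sup.mpr ⟨_, ⟨w, rfl⟩, _, hn, by abel⟩

lemma Isub_eq_bot_iff (n : ℕ) (q : ℤ) :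
    Isub C d F n q = ⊥ ↔ cyc C d q ⊓ F n (q + 1) ≤ LinearMap.range (d (q + 1)) := by
  rw [Isub, ← LinearMap.le_ker_iff_map, Submodule.ker_mkQ]
  exact ⟨fun h x hx => @h ⟨x, hx.1⟩ hx.2, fun h x hx => h ⟨x.2, hx⟩⟩

lemma finiteDimensional_Hgrp_of_Isub_eq_bot (n : ℕ) (q : ℤ)
    [FiniteDimensional ℚ (C (q + 1) ⧸ F n (q + 1))] (h : Isub C d F n q = ⊥) :
    FiniteDimensional ℚ (Hgrp C d q) := by
  let φ : ↥(cyc C d q) →ₗ[ℚ] C (q + 1) ⧸ F n (q + 1) :=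
    (F n (q + 1)).mkQ.comp (cyc C d q).subtype
  have hφ : LinearMap.ker φ ≤ bdry C d q := by
    rw [Isub, ← LinearMap.le_ker_iff_map, Submodule.ker_mkQ] at h
    rwa [LinearMap.ker_comp, Submodule.ker_mkQ]
  have : FiniteDimensional ℚ (↥(cyc C d q) ⧸ LinearMap.ker φ) :=
    φ.quotKerEquivRange.symm.finiteDimensional
  exact Module.Finite.of_surjective _ (Submodule.factor_surjective hφ)

/-- Suppose each `C_q` has countable dimension over ℚ.  If the canonical map
`H_q(C) → H_q(Ĉ)` is bijective for every `q`, then every `H_q(C)` is finite dimensional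
and for each `q` there is an `n` with `I^n = 0` in degree `q+1`. -/
theorem finiteDimensional_homology_of_bijective_Hmap
    (hcount : ∀ q, Module.rank ℚ (C q) ≤ Cardinal.aleph0)
    (hdd : ∀ q : ℤ, (d q).comp (d (q + 1)) = 0)
    (hF0 : ∀ q, F 0 q = ⊤)
    (hFmono : ∀ n q, F (n + 1) q ≤ F n q)
    (hFd : ∀ n q, ∀ x ∈ F n (q + 1), d q x ∈ F n q)
    (hFfin : ∀ n q, FiniteDimensional ℚ (C q ⧸ F n q))
    (hbij : ∀ q, Function.Bijective (Hmap C d F hFmono hFd q)) :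
    ∀ q, FiniteDimensional ℚ (Hgrp C d q) ∧ ∃ n, Isub C d F n q = ⊥ := by
  intro q
  have hFanti : ∀ q, Antitone fun n => F n q := fun q => antitone_nat_of_succ_le fun n => hFmono n q
  have := countable_of_rank_le_aleph0 (hcount (q + 1))
  obtain ⟨n, hn⟩ := exists_inf_le_of_countable_of_complete (hFanti (q + 1)) (cyc C d q)
    (LinearMap.range (d (q + 1)))
    (fun z hz hzn => by
      obtain ⟨w, hw⟩ := exists_compatible_approx_preimage (d (q + 1))
        (G := fun n => F n (q + 1 + 1)) (hF0 _) (hFanti (q + 1)) (fun n => hFd n (q + 1))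
        (fun n => have := hFfin n (q + 1 + 1); inferInstance) z (fun n => by
          obtain ⟨_, ⟨v, rfl⟩, x, hx, rfl⟩ := Submodule.mem_sup.mp (hzn n)
          exact ⟨v, by simpa using hx⟩)
      exact exists_eq_d_of_Hmap_injective C d F hFmono hFd q (hbij q).1 hz
        (fun n => (hw n).1) (fun n => (hw n).2))
    (fun s hs hsF => exists_limit_of_Hmap_surjective C d F hFmono hFd q (hbij q).2 hs hsF)
  have hI := (Isub_eq_bot_iff C d F n q).mpr hn
  have := hFfin n (q + 1)
  exact ⟨finiteDimensional_Hgrp_of_Isub_eq_bot C d F n q hI, n, hI⟩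

end ChainComplex
end
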